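/- Let λ be the partition of n whose Young diagram is a union of m rectangles of sizes p_i × q_i (i = 1,…,m) with q_1 ≥ q_2 ≥ ⋯ ≥ q_m, fix k ≥ 1, let μ be a partition of k, and let F_μ(p_1,…,p_m; q_1,…,q_m) = χ̂^λ(μ,1^{n-k}), which is a polynomial function of the p_i and q_i with integer coefficients. Then evaluating this polynomial at p_1 = ⋯ = p_m = 1 and q_1 = ⋯ = q_m = −1 gives (−1)^k F_μ(1,…,1; −1,…,−1) = (k+m−1)_k, where (k+m−1)_k = (k+m−1)(k+m−2)⋯m is the falling factorial. -/

import Mathlib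

open Equiv Finset

/-- The `r`-th power sum polynomial in `n` variables. -/
noncomputable def psum (n r : ℕ) : MvPolynomial (Fin n) ℤ :=
  ∑ i : Fin n, MvPolynomial.X i ^ r

/-- The Vandermonde product `∏_{i<j} (x_i - x_j)`. -/
noncomputable def vdm (n : ℕ) : MvPolynomial (Fin n) ℤ :=
  ∏ i : Fin n, ∏ j ∈ Finset.univ.filter (fun j => i < j),
    (MvPolynomial.X i - MvPolynomial.X j)

/-- The `i`-th largest part of a partition (`0`-indexed; `0` if `i` exceeds the
number of parts). -/
def nthPart {n : ℕ} (lam : n.Partition) (i : ℕ) : ℕ :=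
  ((lam.parts.sort (· ≤ ·)).reverse).getD i 0

/-- The value `χ^λ(μ)` of the irreducible character of the symmetric group `S_n`
indexed by the partition `λ` of `n` on permutations of cycle type `μ`, defined via
the Frobenius character formula: `χ^λ(μ)` is the coefficient of
`x^{λ₁+n-1} x₂^{λ₂+n-2} ⋯ xₙ^{λₙ}` in `∏_{i<j}(x_i-x_j) · ∏_r p_{μ_r}(x)`. -/
noncomputable def chi (n : ℕ) (lam mu : n.Partition) : ℤ :=
  MvPolynomial.coeff
    (Finsupp.equivFunOnFinite.symm fun i : Fin n => nthPart lam i + (n - 1 - i))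
    (vdm n * (mu.parts.map (psum n)).prod)

/-- The partition `(μ, 1^{n-k})` of `n` obtained from a partition `μ` of `k ≤ n`
by appending `n - k` parts equal to `1`. -/
def padOnes {k : ℕ} (n : ℕ) (h : k ≤ n) (mu : Nat.Partition k) : Nat.Partition n where
  parts := mu.parts + Multiset.replicate (n - k) 1
  parts_pos := by
    intro i hi
    rcases Multiset.mem_add.mp hi with h' | h'
    · exact mu.parts_pos h'
    · simpa [Multiset.eq_of_mem_replicate h'] using Nat.one_pos
  parts_sum := by
    simp [Multiset.sum_replicate, mu.parts_sum]
    omega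

/-- The partition of `n` into `n` parts equal to `1`. -/
def onesPartition (n : ℕ) : Nat.Partition n where
  parts := Multiset.replicate n 1
  parts_pos := by
    intro i hi
    simpa [Multiset.eq_of_mem_replicate hi] using Nat.one_pos
  parts_sum := by simp [Multiset.sum_replicate]

/-- The normalized character `χ̂^λ(μ, 1^{n-k}) = (n)_k χ^λ(μ,1^{n-k}) / χ^λ(1^n)`. -/
noncomputable def chihat {k : ℕ} (n : ℕ) (h : k ≤ n) (lam : n.Partition)
    (mu : Nat.Partition k) : ℚ :=
  (n.descFactorial k : ℚ) * (chi n lam (padOnes n h mu) : ℚ) / (chi n lam (onesPartition n) : ℚ)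

/-- `n = ∑ pᵢ qᵢ`, the size of a union of `m` rectangles `pᵢ × qᵢ`. -/
def rectN (m : ℕ) (p q : Fin m → ℕ) : ℕ := ∑ i : Fin m, p i * q i

/-- The partition whose Young diagram is the union of `m` rectangles of sizes
`pᵢ × qᵢ` (with `q₁ ≥ ⋯ ≥ q_m`): it has `pᵢ` parts equal to `qᵢ` for each `i`. -/
def rectShape (m : ℕ) (p q : Fin m → ℕ) (hq : ∀ i, 0 < q i) :
    Nat.Partition (rectN m p q) where
  parts := ∑ i : Fin m, Multiset.replicate (p i) (q i)
  parts_pos := by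
    intro j hj
    rw [Multiset.mem_sum] at hj
    obtain ⟨i, -, hji⟩ := hj
    rw [Multiset.eq_of_mem_replicate hji]
    exact hq i
  parts_sum := by
    rw [Multiset.sum_sum]
    simp [Multiset.sum_replicate, rectN, mul_comm]

section FrobeniusCoefficients

open MvPolynomial hiding psum

lemma vdm_succ (n : ℕ) :
    vdm (n + 1) = rename Fin.castSucc (vdm n) *
      ∏ i : Fin n, (X i.castSucc - X (Fin.last n)) := by
  simp only [vdm, Finset.prod_filter, Fin.prod_univ_castSucc, Fin.castSucc_lt_castSucc_iff,
    Fin.castSucc_lt_last, if_true, Fin.not_lt.2 (Fin.le_last _), map_prod, map_sub, rename_X,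
    apply_ite, map_one, if_false, Finset.prod_const_one, mul_one,
    Finset.prod_mul_distrib]

/-- The specialization of the last variable to `0`. -/
noncomputable def dropLast (n : ℕ) : MvPolynomial (Fin (n + 1)) ℤ →ₐ[ℤ] MvPolynomial (Fin n) ℤ :=
  aeval (Fin.snoc (α := fun _ => MvPolynomial (Fin n) ℤ) X 0)

lemma coeff_snoc_zero {n : ℕ} (b : Fin n → ℕ) (g : MvPolynomial (Fin (n + 1)) ℤ) :
    coeff (Finsupp.equivFunOnFinite.symm (Fin.snoc (α := fun _ => ℕ) b 0)) g =
      coeff (Finsupp.equivFunOnFinite.symm b) (dropLast n g) := by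
  induction g using MvPolynomial.induction_on' with
  | add p q hp hq => simp only [coeff_add, map_add, hp, hq]
  | monomial u a =>
    have hu : dropLast n (monomial u a) = monomial
        (Finsupp.equivFunOnFinite.symm fun i => u i.castSucc)
        (if u (Fin.last n) = 0 then a else 0) := by
      rw [dropLast, aeval_monomial, Finsupp.prod_fintype _ _ (by simp), Fin.prod_univ_castSucc]
      simp only [Fin.snoc_castSucc, Fin.snoc_last]
      rw [monomial_eq, Finsupp.prod_fintype _ _ (by simp)]
      split_ifs with h <;> simp [h]
    rw [hu]
    simp only [coeff_monomial]
    by_cases h : u (Fin.last n) = 0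
    · rw [if_pos h]
      congr 1
      simp only [DFunLike.ext_iff, Fin.forall_fin_succ', Finsupp.equivFunOnFinite_symm_apply_apply,
        Fin.snoc_castSucc, Fin.snoc_last, h, and_true]
    · rw [if_neg h, ite_self, if_neg]
      rintro rfl
      simp at h

lemma dropLast_vdm (n : ℕ) : dropLast n (vdm (n + 1)) = vdm n * ∏ i : Fin n, X i := by
  rw [vdm_succ, map_mul, map_prod, dropLast, aeval_rename]
  congr 1
  · convert AlgHom.id_apply (R := ℤ) (vdm n)
    ext i
    simp
  · simp

lemma dropLast_psum {r : ℕ} (n : ℕ) (hr : 0 < r) : dropLast n (psum (n + 1) r) = psum n r := by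
  simp [psum, dropLast, Fin.sum_univ_castSucc, hr.ne']

lemma coeff_vdm_mul_psum_succ (n : ℕ) (s : Multiset ℕ) (hs : ∀ r ∈ s, 0 < r) (c : ℕ → ℕ)
    (hc : c n = 0) :
    coeff (Finsupp.equivFunOnFinite.symm fun i : Fin (n + 1) => c i + (n + 1 - 1 - i))
        (vdm (n + 1) * (s.map (psum (n + 1))).prod) =
      coeff (Finsupp.equivFunOnFinite.symm fun i : Fin n => c i + (n - 1 - i))
        (vdm n * (s.map (psum n)).prod) := by
  have hsnoc : (fun i : Fin (n + 1) => c i + (n + 1 - 1 - i)) =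
      Fin.snoc (α := fun _ => ℕ) (fun i : Fin n => c i + (n - 1 - i) + 1) 0 := by
    funext i
    refine Fin.lastCases ?_ (fun i => ?_) i
    · simp [hc]
    · simp only [Fin.val_castSucc, Fin.snoc_castSucc]
      have := i.2
      omega
  have hprod : dropLast n (s.map (psum (n + 1))).prod = (s.map (psum n)).prod := by
    rw [map_multiset_prod, Multiset.map_map]
    exact congrArg _ (Multiset.map_congr rfl fun r hr => dropLast_psum n (hs r hr))
  have hX : (∏ i : Fin n, X i : MvPolynomial (Fin n) ℤ) =
      monomial (Finsupp.equivFunOnFinite.symm fun _ => 1) 1 := by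
    rw [monomial_eq, Finsupp.prod_fintype _ _ (by simp)]
    simp
  have hadd : (Finsupp.equivFunOnFinite.symm fun i : Fin n => c i + (n - 1 - i) + 1) =
      (Finsupp.equivFunOnFinite.symm fun i : Fin n => c i + (n - 1 - i)) +
        Finsupp.equivFunOnFinite.symm fun _ => 1 := by
    ext i
    simp
  rw [hsnoc, coeff_snoc_zero, map_mul, dropLast_vdm, hprod, mul_right_comm, hX, hadd,
    coeff_mul_monomial, mul_one]

/-- The Frobenius coefficient does not depend on the number of variables, as long as it is at
least the number of nonzero parts. -/
lemma coeff_vdm_mul_psum_of_le {m n : ℕ} (hmn : m ≤ n) (s : Multiset ℕ) (hs : ∀ r ∈ s, 0 < r)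
    (c : ℕ → ℕ) (hc : ∀ i, m ≤ i → c i = 0) :
    coeff (Finsupp.equivFunOnFinite.symm fun i : Fin n => c i + (n - 1 - i))
        (vdm n * (s.map (psum n)).prod) =
      coeff (Finsupp.equivFunOnFinite.symm fun i : Fin m => c i + (m - 1 - i))
        (vdm m * (s.map (psum m)).prod) := by
  induction n, hmn using Nat.le_induction with
  | base => rfl
  | succ n hn ih => rw [coeff_vdm_mul_psum_succ n s hs c (hc n hn), ih]

lemma coeff_staircase_vdm (n : ℕ) :
    coeff (Finsupp.equivFunOnFinite.symm fun i : Fin n => n - 1 - (i : ℕ)) (vdm n) = 1 := by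
  have h := coeff_vdm_mul_psum_of_le (Nat.zero_le n) 0 (by simp) 0 (by simp)
  simpa [vdm, coeff_one, Subsingleton.elim _ (0 : Fin 0 →₀ ℕ)] using h

lemma isHomogeneous_psum (n r : ℕ) : (psum n r).IsHomogeneous r :=
  IsHomogeneous.sum _ _ _ fun i _ => isHomogeneous_X_pow i r

lemma isHomogeneous_prod_psum (n : ℕ) (s : Multiset ℕ) :
    (s.map (psum n)).prod.IsHomogeneous s.sum := by
  induction s using Multiset.induction_on with
  | empty => simpa using isHomogeneous_one (Fin n) ℤ
  | cons r s ih => simpa using (isHomogeneous_psum n r).mul ih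

lemma isHomogeneous_vdm (n : ℕ) :
    (vdm n).IsHomogeneous (∑ i : Fin n, (n - 1 - (i : ℕ))) := by
  refine IsHomogeneous.prod _ _ _ fun i _ => ?_
  have h := IsHomogeneous.prod (Finset.univ.filter fun j => i < j)
    (fun j => (X i - X j : MvPolynomial (Fin n) ℤ)) (fun _ => 1)
    fun j _ => (isHomogeneous_X ℤ i).sub (isHomogeneous_X ℤ j)
  have hcard : (Finset.univ.filter fun j => i < j).card = n - 1 - (i : ℕ) := by
    rw [Finset.filter_lt_eq_Ioi, Fin.card_Ioi]
  simpa [hcard] using h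

lemma coeff_mul_add_single {σ : Type*} {f g : MvPolynomial σ ℤ} {i : σ} {a : σ →₀ ℕ} {b : ℕ}
    (hf : ∀ d, coeff d f ≠ 0 → d i ≤ a i) (hg : g.IsHomogeneous b) :
    coeff (a + Finsupp.single i b) (f * g) = coeff a f * coeff (Finsupp.single i b) g := by
  classical
  rw [coeff_mul, Finset.sum_eq_single (a, Finsupp.single i b)]
  · rintro ⟨c, d⟩ hcd hne
    rw [Finset.HasAntidiagonal.mem_antidiagonal] at hcd
    dsimp only at hcd ⊢
    by_contra hprod
    obtain ⟨hc, hd⟩ := mul_ne_zero_iff.1 hprod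
    have hci := hf c hc
    have hdeg : d.degree = b := by
      by_contra h
      exact hd (hg.coeff_eq_zero h)
    have hi := DFunLike.congr_fun hcd i
    simp only [Finsupp.add_apply, Finsupp.single_eq_same] at hi
    have hle : Finsupp.single i b ≤ d := Finsupp.single_le_iff.2 (by omega)
    obtain ⟨e, rfl⟩ := exists_add_of_le hle
    have he : e = 0 := by
      rw [map_add, Finsupp.degree_single] at hdeg
      exact (Finsupp.degree_eq_zero_iff e).1 (by omega)
    subst he
    rw [add_zero] at hcd hne
    exact hne (by rw [add_right_cancel hcd])
  · simp

lemma IsHomogeneous.apply_le_of_coeff_ne_zero {σ : Type*} {g : MvPolynomial σ ℤ} {b : ℕ}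
    (hg : g.IsHomogeneous b) (i : σ) (d : σ →₀ ℕ) (hd : coeff d g ≠ 0) : d i ≤ b := by
  by_contra h
  refine hd (hg.coeff_eq_zero fun hdeg => h ?_)
  exact (Finsupp.le_degree i d).trans hdeg.le

lemma coeff_single_prod_psum {n : ℕ} (i : Fin n) (s : Multiset ℕ) (hs : ∀ r ∈ s, 0 < r) :
    coeff (Finsupp.single i s.sum) (s.map (psum n)).prod = 1 := by
  induction s using Multiset.induction_on with
  | empty => simp
  | cons r s ih =>
    rw [Multiset.map_cons, Multiset.prod_cons, Multiset.sum_cons, Finsupp.single_add,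
      coeff_mul_add_single (fun d hd => ?_) (isHomogeneous_prod_psum n s),
      ih fun r hr => hs r (Multiset.mem_cons_of_mem hr), mul_one]
    · have hr : r ≠ 0 := (hs r (Multiset.mem_cons_self r s)).ne'
      simp [psum, coeff_sum, coeff_X_pow, Finsupp.single_left_inj hr]
    · simpa using IsHomogeneous.apply_le_of_coeff_ne_zero (isHomogeneous_psum n r) i d hd

lemma apply_last_eq_zero_of_coeff_rename_ne_zero {n : ℕ} (g : MvPolynomial (Fin n) ℤ)
    (d : Fin (n + 1) →₀ ℕ) (hd : coeff d (rename Fin.castSucc g) ≠ 0) : d (Fin.last n) = 0 := by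
  obtain ⟨u, rfl, -⟩ := coeff_rename_ne_zero _ _ _ hd
  exact Finsupp.mapDomain_of_notMem_range _ _ (by simp [Fin.range_castSucc])

lemma isHomogeneous_prod_X_sub_X_last (n : ℕ) (s : Finset (Fin n)) :
    (∏ i ∈ s, (X i.castSucc - X (Fin.last n)) :
      MvPolynomial (Fin (n + 1)) ℤ).IsHomogeneous s.card := by
  simpa using IsHomogeneous.prod s (fun i => (X i.castSucc - X (Fin.last n) :
    MvPolynomial (Fin (n + 1)) ℤ)) (fun _ => 1)
    fun i _ => (isHomogeneous_X ℤ i.castSucc).sub (isHomogeneous_X ℤ (Fin.last n))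

lemma coeff_single_last_prod_X_sub_X_last (n : ℕ) (s : Finset (Fin n)) :
    coeff (Finsupp.single (Fin.last n) s.card)
      (∏ i ∈ s, (X i.castSucc - X (Fin.last n)) : MvPolynomial (Fin (n + 1)) ℤ) =
        (-1) ^ s.card := by
  induction s using Finset.induction_on with
  | empty => simp
  | insert i s hi ih =>
    rw [Finset.prod_insert hi, Finset.card_insert_of_notMem hi, add_comm s.card,
      Finsupp.single_add, coeff_mul_add_single (fun d hd => ?_)
      (isHomogeneous_prod_X_sub_X_last n s), ih, pow_add]
    · congr 1
      simp [coeff_X, Finsupp.single_left_inj, (Fin.castSucc_lt_last i).ne]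
    · simpa using IsHomogeneous.apply_le_of_coeff_ne_zero
        ((isHomogeneous_X ℤ i.castSucc).sub (isHomogeneous_X ℤ (Fin.last n))) (Fin.last n) d hd

lemma apply_last_le_of_coeff_vdm_ne_zero (n : ℕ) (d : Fin (n + 1) →₀ ℕ)
    (hd : coeff d (vdm (n + 1)) ≠ 0) : d (Fin.last n) ≤ n := by
  classical
  rw [vdm_succ, coeff_mul] at hd
  obtain ⟨⟨a, b⟩, hab, hne⟩ := Finset.exists_ne_zero_of_sum_ne_zero hd
  rw [Finset.HasAntidiagonal.mem_antidiagonal] at hab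
  obtain ⟨ha, hb⟩ := mul_ne_zero_iff.1 hne
  have ha' := apply_last_eq_zero_of_coeff_rename_ne_zero _ _ ha
  have hb' := IsHomogeneous.apply_le_of_coeff_ne_zero
    (isHomogeneous_prod_X_sub_X_last n Finset.univ) (Fin.last n) _ hb
  rw [Finset.card_univ, Fintype.card_fin] at hb'
  rw [← hab, Finsupp.add_apply, ha', zero_add]
  exact hb'

/-- The exponent `(n-1, …, 1, 0, n)`. -/
noncomputable def rotatedStaircase (n : ℕ) : Fin (n + 1) →₀ ℕ :=
  Finsupp.equivFunOnFinite.symm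
    (Fin.snoc (α := fun _ => ℕ) (fun i : Fin n => n - 1 - (i : ℕ)) n)

lemma coeff_rotatedStaircase_vdm (n : ℕ) :
    coeff (rotatedStaircase n) (vdm (n + 1)) = (-1) ^ n := by
  have hsplit : rotatedStaircase n =
      Finsupp.mapDomain Fin.castSucc
        (Finsupp.equivFunOnFinite.symm fun i : Fin n => n - 1 - (i : ℕ)) +
      Finsupp.single (Fin.last n) (Finset.univ : Finset (Fin n)).card := by
    simp only [DFunLike.ext_iff, Fin.forall_fin_succ', Finsupp.add_apply]
    refine ⟨fun i => ?_, ?_⟩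
    · rw [Finsupp.mapDomain_apply (Fin.castSucc_injective n)]
      simp [rotatedStaircase, (Fin.castSucc_lt_last i).ne]
    · rw [Finsupp.mapDomain_of_notMem_range _ _ (by simp [Fin.range_castSucc])]
      simp [rotatedStaircase]
  rw [vdm_succ, hsplit, coeff_mul_add_single (fun d hd => ?_)
    (isHomogeneous_prod_X_sub_X_last n Finset.univ), coeff_single_last_prod_X_sub_X_last,
    coeff_rename_mapDomain _ (Fin.castSucc_injective n), coeff_staircase_vdm, one_mul,
    Finset.card_univ, Fintype.card_fin]
  rw [apply_last_eq_zero_of_coeff_rename_ne_zero _ _ hd]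
  exact Nat.zero_le _

/-- The linear map sending the monomial `x^α` to `∏ᵢ yᵢ (yᵢ - 1) ⋯ (yᵢ - αᵢ + 1)`. -/
noncomputable def fallingMap {σ R : Type*} [Fintype σ] [CommRing R] (y : σ → R) :
    MvPolynomial σ ℤ →ₗ[ℤ] R :=
  (basisMonomials σ ℤ).constr ℤ fun α => ∏ i, ∏ j ∈ Finset.range (α i), (y i - j)

lemma fallingMap_monomial {σ R : Type*} [Fintype σ] [CommRing R] (y : σ → R) (α : σ →₀ ℕ)
    (c : ℤ) :
    fallingMap y (monomial α c) = c * ∏ i, ∏ j ∈ Finset.range (α i), (y i - j) := by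
  have h := (basisMonomials σ ℤ).constr_basis ℤ
    (fun α => ∏ i, ∏ j ∈ Finset.range (α i), (y i - j)) α
  rw [coe_basisMonomials] at h
  rw [← mul_one c, ← smul_eq_mul, ← smul_monomial, map_smul, fallingMap, h]
  simp

lemma fallingMap_eq_sum {σ R : Type*} [Fintype σ] [CommRing R] (y : σ → R)
    (g : MvPolynomial σ ℤ) :
    fallingMap y g =
      ∑ α ∈ g.support, ((coeff α g : ℤ) : R) * ∏ i, ∏ j ∈ Finset.range (α i), (y i - j) := by
  conv_lhs => rw [← support_sum_monomial_coeff g]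
  simp only [map_sum, fallingMap_monomial]

lemma map_fallingMap {σ R S : Type*} [Fintype σ] [CommRing R] [CommRing S] (f : R →+* S)
    (y : σ → R) (g : MvPolynomial σ ℤ) :
    f (fallingMap y g) = fallingMap (fun i => f (y i)) g := by
  simp [fallingMap_eq_sum]

/-- Multiplying by a power of `p₁` and extracting a coefficient is, up to factorials, evaluating
`fallingMap`. -/
lemma prod_factorial_mul_coeff_mul_psum_one_pow {n : ℕ} (l : Fin n → ℕ) (r : ℕ)
    (g : MvPolynomial (Fin n) ℤ) {d : ℕ} (hg : g.IsHomogeneous d) (hd : d + r = ∑ i, l i) :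
    (∏ i, ((l i).factorial : ℤ)) *
        coeff (Finsupp.equivFunOnFinite.symm l) (g * psum n 1 ^ r) =
      r.factorial * fallingMap (fun i => (l i : ℤ)) g := by
  have key : ∀ (r : ℕ) (α : Fin n →₀ ℕ), α.degree + r = ∑ i, l i →
      (∏ i, ((l i).factorial : ℤ)) *
        coeff (Finsupp.equivFunOnFinite.symm l) (monomial α 1 * psum n 1 ^ r) =
      r.factorial * ∏ i, ∏ j ∈ Finset.range (α i), ((l i : ℤ) - j) := by
    intro r
    induction r with
    | zero =>
      intro α hα
      rw [Finsupp.degree_eq_sum, add_zero] at hα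
      rw [pow_zero, mul_one, coeff_monomial, Nat.factorial_zero, Nat.cast_one, one_mul]
      split_ifs with h
      · subst h
        rw [mul_one]
        refine Finset.prod_congr rfl fun i _ => ?_
        rw [← Nat.descFactorial_self, Nat.descFactorial_eq_prod_range, Nat.cast_prod]
        refine Finset.prod_congr rfl fun j hj => ?_
        exact Nat.cast_sub (Finset.mem_range.1 hj).le
      · rw [mul_zero]
        obtain ⟨i, hi⟩ : ∃ i, l i < α i := by
          by_contra! hle
          refine h (DFunLike.ext _ _ fun i => ?_)
          exact (Finset.sum_eq_sum_iff_of_le fun i _ => hle i).1 hα i (Finset.mem_univ i)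
        symm
        refine Finset.prod_eq_zero (Finset.mem_univ i) ?_
        exact Finset.prod_eq_zero (Finset.mem_range.2 hi) (sub_self _)
    | succ r ih =>
      intro α hα
      have hexp : (monomial α (1 : ℤ)) * psum n 1 ^ (r + 1) =
          ∑ i, monomial (α + Finsupp.single i 1) 1 * psum n 1 ^ r := by
        rw [← Finset.sum_mul, pow_succ', ← mul_assoc]
        congr 1
        simp [psum, Finset.mul_sum, X, monomial_mul]
      have hstep : ∀ i, ∏ i', ∏ j ∈ Finset.range ((α + Finsupp.single i 1 : Fin n →₀ ℕ) i'),
          ((l i' : ℤ) - j) =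
          ((l i : ℤ) - α i) * ∏ i', ∏ j ∈ Finset.range (α i'), ((l i' : ℤ) - j) := by
        intro i
        rw [← Finset.mul_prod_erase _ _ (Finset.mem_univ i),
          ← Finset.mul_prod_erase _ (fun i' => ∏ j ∈ Finset.range (α i'), ((l i' : ℤ) - j))
            (Finset.mem_univ i)]
        rw [Finsupp.add_apply, Finsupp.single_eq_same, Finset.prod_range_succ,
          mul_comm _ ((l i : ℤ) - α i), mul_assoc]
        congr 2
        refine Finset.prod_congr rfl fun i' hi' => ?_
        rw [Finsupp.add_apply, Finsupp.single_eq_of_ne (Finset.ne_of_mem_erase hi'), add_zero]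
      rw [hexp, coeff_sum, Finset.mul_sum]
      have hsum : ∑ i, ((l i : ℤ) - α i) = r + 1 := by
        rw [Finset.sum_sub_distrib]
        rw [Finsupp.degree_eq_sum] at hα
        push_cast [← Nat.cast_sum, ← hα]
        ring
      calc _ = ∑ i, (r.factorial : ℤ) * (((l i : ℤ) - α i) *
              ∏ i', ∏ j ∈ Finset.range (α i'), ((l i' : ℤ) - j)) := by
            refine Finset.sum_congr rfl fun i _ => ?_
            rw [ih, hstep]
            rw [map_add, Finsupp.degree_single]
            omega
        _ = _ := by
            rw [← Finset.mul_sum, ← Finset.sum_mul, hsum, Nat.factorial_succ]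
            push_cast
            ring
  conv_lhs => rw [← support_sum_monomial_coeff g]
  rw [fallingMap_eq_sum, Finset.sum_mul, coeff_sum, Finset.mul_sum, Finset.mul_sum]
  refine Finset.sum_congr rfl fun α hα => ?_
  have hdeg : α.degree = d := by
    by_contra h
    exact mem_support_iff.1 hα (hg.coeff_eq_zero h)
  have hk := key r α (by omega)
  have hmono : monomial α (coeff α g) = coeff α g • monomial α (1 : ℤ) := by
    rw [smul_monomial, smul_eq_mul, mul_one]
  rw [hmono, smul_mul_assoc, coeff_smul, smul_eq_mul, mul_left_comm, hk, Int.cast_id]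
  ring

/-- At the staircase shifted down by one, a single monomial survives. -/
lemma fallingMap_vdm_mul_prod_psum (n : ℕ) (s : Multiset ℕ) (hs : ∀ r ∈ s, 0 < r) :
    fallingMap (fun i : Fin (n + 1) => (n : ℤ) - 1 - (i : ℕ))
        (vdm (n + 1) * (s.map (psum (n + 1))).prod) =
      (-1) ^ n * (∏ i : Fin n, ((n - 1 - (i : ℕ)).factorial : ℤ)) *
        ∏ j ∈ Finset.range (n + s.sum), (-1 - (j : ℤ)) := by
  classical
  set g := (s.map (psum (n + 1))).prod with hg
  have hghom : g.IsHomogeneous s.sum := isHomogeneous_prod_psum _ s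
  have hcoeff : coeff (rotatedStaircase n + Finsupp.single (Fin.last n) s.sum)
      (vdm (n + 1) * g) = (-1) ^ n := by
    rw [coeff_mul_add_single (fun d hd => ?_) hghom, coeff_single_prod_psum _ _ hs,
      coeff_rotatedStaircase_vdm, mul_one]
    simpa [rotatedStaircase] using apply_last_le_of_coeff_vdm_ne_zero n d hd
  rw [fallingMap_eq_sum,
    Finset.sum_eq_single (rotatedStaircase n + Finsupp.single (Fin.last n) s.sum)]
  · rw [hcoeff, Fin.prod_univ_castSucc, mul_assoc]
    push_cast
    congr 2
    · refine Finset.prod_congr rfl fun i _ => ?_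
      rw [← Nat.descFactorial_self, Nat.descFactorial_eq_prod_range, Nat.cast_prod]
      have hi := i.2
      have he : (rotatedStaircase n + Finsupp.single (Fin.last n) s.sum : _ →₀ ℕ) i.castSucc =
          n - 1 - (i : ℕ) := by
        simp [rotatedStaircase, (Fin.castSucc_lt_last i).ne]
      rw [← Finsupp.coe_add, he, Fin.val_castSucc]
      refine Finset.prod_congr rfl fun j hj => ?_
      rw [Finset.mem_range] at hj
      omega
    · simp [rotatedStaircase]
  · intro α hα hne
    by_contra hprod
    have hne0 := right_ne_zero_of_mul hprod
    have hlt : ∀ i : Fin n, α i.castSucc ≤ n - 1 - (i : ℕ) := by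
      intro i
      by_contra! hi
      refine hne0 (Finset.prod_eq_zero (Finset.mem_univ i.castSucc)
        (Finset.prod_eq_zero (Finset.mem_range.2 hi) ?_))
      have := i.2
      simp only [Fin.val_castSucc]
      omega
    have hlast : α (Fin.last n) ≤ n + s.sum := by
      have hα' := mem_support_iff.1 hα
      rw [coeff_mul] at hα'
      obtain ⟨⟨a, b⟩, hab, hab0⟩ := Finset.exists_ne_zero_of_sum_ne_zero hα'
      rw [Finset.HasAntidiagonal.mem_antidiagonal] at hab
      obtain ⟨ha, hb⟩ := mul_ne_zero_iff.1 hab0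
      rw [← hab, Finsupp.add_apply]
      exact add_le_add (apply_last_le_of_coeff_vdm_ne_zero n a ha)
        (IsHomogeneous.apply_le_of_coeff_ne_zero hghom _ b hb)
    have hdeg : α.degree = ∑ i : Fin (n + 1), (n + 1 - 1 - (i : ℕ)) + s.sum := by
      by_contra h
      exact mem_support_iff.1 hα (((isHomogeneous_vdm (n + 1)).mul hghom).coeff_eq_zero h)
    have hstair : ∑ i : Fin (n + 1), (n + 1 - 1 - (i : ℕ)) =
        ∑ i : Fin n, (n - 1 - (i : ℕ)) + n := by
      rw [Fin.sum_univ_succ, add_comm]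
      simp only [Fin.val_zero, Fin.val_succ]
      congr 1
      exact Finset.sum_congr rfl fun i _ => by omega
    rw [Finsupp.degree_eq_sum, Fin.sum_univ_castSucc, hstair] at hdeg
    have hsumle : ∑ i : Fin n, α i.castSucc ≤ ∑ i : Fin n, (n - 1 - (i : ℕ)) :=
      Finset.sum_le_sum fun i _ => hlt i
    have heq := (Finset.sum_eq_sum_iff_of_le fun i _ => hlt i).1
      (show ∑ i : Fin n, α i.castSucc = ∑ i : Fin n, (n - 1 - (i : ℕ)) by omega)
    refine hne ?_
    simp only [DFunLike.ext_iff, Fin.forall_fin_succ', Finsupp.add_apply]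
    refine ⟨fun i => ?_, ?_⟩
    · simp [rotatedStaircase, heq i (Finset.mem_univ i), (Fin.castSucc_lt_last i).ne]
    · simp only [rotatedStaircase, Finsupp.equivFunOnFinite_symm_apply_apply, Fin.snoc_last,
        Finsupp.single_eq_same]
      omega
  · intro h
    rw [notMem_support_iff, hcoeff] at h
    exact absurd h (pow_ne_zero _ (by norm_num))

lemma nthPart_rectShape_one (m t : ℕ) (ht : 0 < t) (i : ℕ) :
    nthPart (rectShape m (fun _ => 1) (fun _ => t) fun _ => ht) i = if i < m then t else 0 := by
  have hparts : (rectShape m (fun _ => 1) (fun _ => t) fun _ => ht).parts =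
      (List.replicate m t : Multiset ℕ) := by
    rw [Multiset.coe_replicate]
    simp [rectShape, ← Multiset.nsmul_singleton]
  have hsort : (List.replicate m t : Multiset ℕ).sort (· ≤ ·) = List.replicate m t :=
    List.perm_replicate.1 (Multiset.coe_eq_coe.1 (Multiset.sort_eq _ _))
  rw [nthPart, hparts, hsort, List.reverse_replicate]
  split_ifs with h
  · exact List.getD_replicate t h
  · exact List.getD_eq_default _ _ (by simpa using h)

lemma prod_factorial_mul_chi_rectShape {n t r : ℕ} (ht : 0 < t) (s : Multiset ℕ)
    (nu : (rectN (n + 1) (fun _ => 1) fun _ => t).Partition)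
    (hnu : nu.parts = s + Multiset.replicate r 1) :
    (∏ i : Fin (n + 1), ((t + (n - (i : ℕ))).factorial : ℤ)) *
        chi _ (rectShape (n + 1) (fun _ => 1) (fun _ => t) fun _ => ht) nu =
      r.factorial * fallingMap (fun i : Fin (n + 1) => (t : ℤ) + n - (i : ℕ))
        (vdm (n + 1) * (s.map (psum (n + 1))).prod) := by
  have hN : rectN (n + 1) (fun _ => 1) (fun _ => t) = (n + 1) * t := by simp [rectN]
  have hle : n + 1 ≤ rectN (n + 1) (fun _ => 1) (fun _ => t) := by
    rw [hN]
    exact Nat.le_mul_of_pos_right _ ht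
  have hsum : s.sum + r = (n + 1) * t := by
    have h := nu.parts_sum
    rw [hnu, hN] at h
    simpa using h
  simp only [chi, nthPart_rectShape_one]
  rw [coeff_vdm_mul_psum_of_le hle nu.parts (fun _ h => nu.parts_pos h)
    (fun i => if i < n + 1 then t else 0) fun i hi => if_neg (by omega)]
  have hl : (fun i : Fin (n + 1) => (if (i : ℕ) < n + 1 then t else 0) + (n + 1 - 1 - (i : ℕ))) =
      fun i : Fin (n + 1) => t + (n - (i : ℕ)) := by
    funext i
    rw [if_pos i.2, Nat.add_sub_cancel]
  rw [hl, hnu, Multiset.map_add, Multiset.prod_add, Multiset.map_replicate,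
    Multiset.prod_replicate, ← mul_assoc, prod_factorial_mul_coeff_mul_psum_one_pow
      (fun i : Fin (n + 1) => t + (n - (i : ℕ))) r _
      ((isHomogeneous_vdm (n + 1)).mul (isHomogeneous_prod_psum (n + 1) s))]
  · congr 3
    funext i
    have := i.2
    push_cast [Nat.cast_sub (Nat.lt_succ_iff.1 this)]
    ring
  · rw [Finset.sum_add_distrib, add_assoc, hsum]
    simp [add_comm]

lemma chihat_rectShape_mul {k n t : ℕ} (ht : 0 < t) (mu : Nat.Partition k)
    (h : k ≤ rectN (n + 1) (fun _ => 1) fun _ => t)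
    (h0 : fallingMap (fun i : Fin (n + 1) => (t : ℤ) + n - (i : ℕ)) (vdm (n + 1)) ≠ 0) :
    chihat _ h (rectShape (n + 1) (fun _ => 1) (fun _ => t) fun _ => ht) mu *
        (fallingMap (fun i : Fin (n + 1) => (t : ℤ) + n - (i : ℕ)) (vdm (n + 1)) : ℤ) =
      (fallingMap (fun i : Fin (n + 1) => (t : ℤ) + n - (i : ℕ))
        (vdm (n + 1) * (mu.parts.map (psum (n + 1))).prod) : ℤ) := by
  have hmu := prod_factorial_mul_chi_rectShape ht mu.parts
    (padOnes _ h mu) rfl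
  have hone := prod_factorial_mul_chi_rectShape ht 0
    (onesPartition (rectN (n + 1) (fun _ => 1) fun _ => t)) (zero_add _).symm
  rw [Multiset.map_zero, Multiset.prod_zero, mul_one] at hone
  have hfac := Nat.factorial_mul_descFactorial h
  rw [chihat]
  set N := rectN (n + 1) (fun _ => 1) fun _ => t
  set F := ∏ i : Fin (n + 1), ((t + (n - (i : ℕ))).factorial : ℤ)
  set A := fallingMap (fun i : Fin (n + 1) => (t : ℤ) + n - (i : ℕ)) (vdm (n + 1))
  set B := fallingMap (fun i : Fin (n + 1) => (t : ℤ) + n - (i : ℕ))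
        (vdm (n + 1) * (mu.parts.map (psum (n + 1))).prod)
  set x := chi N (rectShape (n + 1) (fun _ => 1) (fun _ => t) fun _ => ht) (padOnes N h mu)
  set y := chi N (rectShape (n + 1) (fun _ => 1) (fun _ => t) fun _ => ht) (onesPartition N)
  have hFy : F * y ≠ 0 := by
    rw [hone]
    exact mul_ne_zero (by exact_mod_cast N.factorial_ne_zero) h0
  have hy : (y : ℚ) ≠ 0 := by exact_mod_cast right_ne_zero_of_mul hFy
  have hF : (F : ℚ) ≠ 0 := by exact_mod_cast left_ne_zero_of_mul hFy
  have hr : ((N - k).factorial : ℚ) ≠ 0 := by exact_mod_cast (N - k).factorial_ne_zero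
  have hmu' : (F : ℚ) * x = (N - k).factorial * B := by exact_mod_cast hmu
  have hone' : (F : ℚ) * y = N.factorial * A := by exact_mod_cast hone
  have hfac' : ((N - k).factorial : ℚ) * N.descFactorial k = N.factorial := by
    exact_mod_cast hfac
  rw [div_mul_eq_mul_div, div_eq_iff hy]
  refine mul_left_cancel₀ (mul_ne_zero hr hF) ?_
  linear_combination (N - k).factorial * N.descFactorial k * A * hmu' -
    (N - k).factorial * B * hone' + (N - k).factorial * A * B * hfac'

end FrobeniusCoefficients

/-- If `P` is the integer polynomial representing the normalized
character `F_μ(p₁,…,p_m;q₁,…,q_m) = χ̂^λ(μ,1^{n-k})` of Proposition 1 (for `λ` the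
union of `m` rectangles `pᵢ × qᵢ`), then
`(-1)^k F_μ(1,…,1;-1,…,-1) = (k+m-1)_k`, the falling factorial. -/
theorem stmt1 (k m : ℕ) (hk : 1 ≤ k) (hm : 1 ≤ m) (mu : Nat.Partition k)
    (P : MvPolynomial (Fin m ⊕ Fin m) ℤ)
    (hP : ∀ (p q : Fin m → ℕ) (hp : ∀ i, 0 < p i) (hq : ∀ i, 0 < q i)
      (hmono : Antitone q) (hkn : k ≤ rectN m p q),
        chihat (rectN m p q) hkn (rectShape m p q hq) mu =
          ((MvPolynomial.eval (Sum.elim (fun i => (p i : ℤ)) fun i => (q i : ℤ)) P : ℤ) : ℚ)) :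
    (-1) ^ k *
        MvPolynomial.eval (Sum.elim (fun _ => (1 : ℤ)) fun _ => (-1 : ℤ)) P =
      (k + m - 1).descFactorial k := by
  obtain ⟨n, rfl⟩ : ∃ n, m = n + 1 := ⟨m - 1, by omega⟩
  let y : Fin (n + 1) → Polynomial ℤ := fun i => Polynomial.X + (n : Polynomial ℤ) - ((i : ℕ) : Polynomial ℤ)
  let A : Polynomial ℤ := fallingMap y (vdm (n + 1))
  let B : Polynomial ℤ := fallingMap y (vdm (n + 1) * (mu.parts.map (psum (n + 1))).prod)
  let Q : Polynomial ℤ :=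
    MvPolynomial.aeval (Sum.elim (fun _ => (1 : Polynomial ℤ)) fun _ => Polynomial.X) P
  have heval : ∀ (t : ℤ) (g : MvPolynomial (Fin (n + 1)) ℤ),
      (fallingMap y g).eval t = fallingMap (fun i : Fin (n + 1) => t + n - (i : ℕ)) g := by
    intro t g
    rw [← Polynomial.coe_evalRingHom, map_fallingMap]
    simp [y]
  have hQ : ∀ t : ℤ, Q.eval t =
      MvPolynomial.eval (Sum.elim (fun _ => (1 : ℤ)) fun _ => t) P := by
    intro t
    have hcomp := MvPolynomial.map_aeval
      (Sum.elim (fun _ : Fin (n + 1) => (1 : Polynomial ℤ)) fun _ : Fin (n + 1) => Polynomial.X)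
      (Polynomial.evalRingHom t) P
    rw [Polynomial.coe_evalRingHom] at hcomp
    rw [hcomp, MvPolynomial.eval, MvPolynomial.coe_eval₂Hom, MvPolynomial.coe_eval₂Hom]
    congr 1
    · exact RingHom.ext_int _ _
    · funext i
      rcases i with i | i <;> simp
  have hshift : ∀ g : MvPolynomial (Fin (n + 1)) ℤ, (fallingMap y g).eval (-1) =
      fallingMap (fun i : Fin (n + 1) => (n : ℤ) - 1 - (i : ℕ)) g := by
    intro g
    rw [heval, neg_add_eq_sub]
  have hA := fallingMap_vdm_mul_prod_psum n 0 (by simp)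
  rw [Multiset.map_zero, Multiset.prod_zero, mul_one, Multiset.sum_zero, add_zero, ← hshift] at hA
  have hB := fallingMap_vdm_mul_prod_psum n mu.parts fun _ h => mu.parts_pos h
  rw [mu.parts_sum, ← hshift, Finset.prod_range_add, ← mul_assoc, ← hA] at hB
  have hA1 : A.eval (-1) ≠ 0 := by
    rw [hA]
    refine mul_ne_zero (mul_ne_zero (pow_ne_zero _ (by norm_num)) ?_) ?_
    · exact Finset.prod_ne_zero_iff.2 fun i _ => by exact_mod_cast Nat.factorial_ne_zero _
    · exact Finset.prod_ne_zero_iff.2 fun j _ => by omega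
  have hA0 : A ≠ 0 := by
    rintro h
    simp [h] at hA1
  have hQAB : Q * A = B := by
    refine mul_left_cancel₀ hA0 (Polynomial.eq_of_infinite_eval_eq _ _ ?_)
    refine Set.Infinite.mono ?_ ((Set.infinite_range_of_injective
      (f := fun j : ℕ => ((j + k : ℕ) : ℤ)) fun a b hab => by simpa using hab))
    rintro _ ⟨j, rfl⟩
    have ht : 0 < j + k := by omega
    have hkn : k ≤ rectN (n + 1) (fun _ => 1) fun _ => j + k := by
      simp only [rectN, one_mul, Finset.sum_const, Finset.card_univ, Fintype.card_fin, smul_eq_mul]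
      nlinarith
    simp only [Set.mem_ofPred_eq, Polynomial.eval_mul]
    by_cases h0 : A.eval ((j + k : ℕ) : ℤ) = 0
    · rw [h0, zero_mul, zero_mul]
    congr 1
    have hchi := chihat_rectShape_mul ht mu hkn (by rwa [← heval])
    rw [hP _ _ (fun _ => one_pos) (fun _ => ht) antitone_const hkn, ← heval, ← heval] at hchi
    rw [hQ]
    exact_mod_cast hchi
  have hfinal := congrArg (Polynomial.eval (-1)) hQAB
  rw [Polynomial.eval_mul, hB, mul_comm] at hfinal
  rw [← hQ, mul_left_cancel₀ hA1 hfinal, show k + (n + 1) - 1 = n + k by omega,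
    Nat.add_descFactorial_eq_ascFactorial, Nat.ascFactorial_eq_prod_range, Nat.cast_prod]
  conv_lhs => rw [← Finset.card_range k, ← Finset.prod_const, Finset.card_range,
    ← Finset.prod_mul_distrib]
  refine Finset.prod_congr rfl fun j _ => ?_
  push_cast
  ring
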